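/- arXiv:1809.01595 — 2 statements merged into one kernel-verified Lean document; each statement's English description precedes it below -/
import Mathlib

section
/- For every l ∈ ℕ, the mixed derivative of P_l ∘ h along V in the x-variables and V in the y-variables, evaluated on the diagonal, satisfies V_x V_y P_l(h)|_{x=y} = ‖V‖²(θ, φ) P_l'(1), where ‖V‖²(θ, φ) = sin²(φ) v₁(θ, φ)² + v₂(θ, φ)². -/
open Real

/-- The degree-`l` Legendre polynomial, via the Rodrigues formula
`P_l(t) = 1/(2^l l!) dˡ/dtˡ (t² − 1)ˡ`. -/
noncomputable def legP (l : ℕ) : ℝ → ℝ :=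
  fun t => (1 / (2 ^ l * (Nat.factorial l : ℝ))) * iteratedDeriv l (fun s => (s ^ 2 - 1) ^ l) t

/-- `h(θ_x, φ_x, θ_y, φ_y)`, the cosine of the spherical distance. -/
noncomputable def sphH (θx φx θy φy : ℝ) : ℝ :=
  Real.cos φx * Real.cos φy + Real.sin φx * Real.sin φy * Real.cos (θx - θy)

/-- Functions of the four variables `(θ_x, φ_x, θ_y, φ_y)`. -/
abbrev F4 : Type := ℝ → ℝ → ℝ → ℝ → ℝ

/-- `∂/∂θ_x`. -/
noncomputable def pθx (f : F4) : F4 := fun a b c d => deriv (fun t => f t b c d) a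
/-- `∂/∂φ_x`. -/
noncomputable def pφx (f : F4) : F4 := fun a b c d => deriv (fun t => f a t c d) b
/-- `∂/∂θ_y`. -/
noncomputable def pθy (f : F4) : F4 := fun a b c d => deriv (fun t => f a b t d) c
/-- `∂/∂φ_y`. -/
noncomputable def pφy (f : F4) : F4 := fun a b c d => deriv (fun t => f a b c t) d

/-- The operator `V_x = v₁(θ_x,φ_x) ∂/∂θ_x + v₂(θ_x,φ_x) ∂/∂φ_x`. -/
noncomputable def Vx (v₁ v₂ : ℝ → ℝ → ℝ) (f : F4) : F4 :=
  fun a b c d => v₁ a b * pθx f a b c d + v₂ a b * pφx f a b c d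

/-- The operator `V_y = v₁(θ_y,φ_y) ∂/∂θ_y + v₂(θ_y,φ_y) ∂/∂φ_y`. -/
noncomputable def Vy (v₁ v₂ : ℝ → ℝ → ℝ) (f : F4) : F4 :=
  fun a b c d => v₁ c d * pθy f a b c d + v₂ c d * pφy f a b c d

/-- The operator `V_x^⊥ = v₂(θ_x,φ_x) ∂/∂θ_x − sin²(φ_x) v₁(θ_x,φ_x) ∂/∂φ_x`. -/
noncomputable def Vxp (v₁ v₂ : ℝ → ℝ → ℝ) (f : F4) : F4 :=
  fun a b c d => v₂ a b * pθx f a b c d - (Real.sin b) ^ 2 * v₁ a b * pφx f a b c d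

/-- The operator `V_y^⊥ = v₂(θ_y,φ_y) ∂/∂θ_y − sin²(φ_y) v₁(θ_y,φ_y) ∂/∂φ_y`. -/
noncomputable def Vyp (v₁ v₂ : ℝ → ℝ → ℝ) (f : F4) : F4 :=
  fun a b c d => v₂ c d * pθy f a b c d - (Real.sin d) ^ 2 * v₁ c d * pφy f a b c d

/-- `P_l ∘ h` as a function of the four variables. -/
noncomputable def PH (l : ℕ) : F4 := fun a b c d => legP l (sphH a b c d)

theorem contDiff_legP (l : ℕ) : ContDiff ℝ (⊤ : ℕ∞) (legP l) := by
  unfold legP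
  simp only [iteratedDeriv_eq_iterate]
  fun_prop

theorem differentiable_legP (l : ℕ) : Differentiable ℝ (legP l) :=
  (contDiff_legP l).differentiable (by simp)

theorem differentiable_deriv_legP (l : ℕ) : Differentiable ℝ (deriv (legP l)) :=
  ((contDiff_legP l).iterate_deriv 1).differentiable (by simp)

theorem sphH_diagonal (θ φ : ℝ) : sphH θ φ θ φ = 1 := by
  simp only [sphH, sub_self, cos_zero, mul_one]
  linear_combination cos_sq_add_sin_sq φ

theorem hasDerivAt_sphH_θy (a b c d : ℝ) :
    HasDerivAt (fun t => sphH a b t d) (sin b * sin d * sin (a - c)) c := by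
  have h := (((hasDerivAt_id c).const_sub a).cos.const_mul (sin b * sin d)).const_add
    (cos b * cos d)
  exact h.congr_deriv (by simp)

theorem hasDerivAt_sphH_φy (a b c d : ℝ) :
    HasDerivAt (fun t => sphH a b c t) (sin b * cos d * cos (a - c) - cos b * sin d) d := by
  have h := ((hasDerivAt_cos d).const_mul (cos b)).add
    (((hasDerivAt_sin d).const_mul (sin b)).mul_const (cos (a - c)))
  exact h.congr_deriv (by ring)

theorem Vy_PH (v₁ v₂ : ℝ → ℝ → ℝ) (l : ℕ) (a b c d : ℝ) :
    Vy v₁ v₂ (PH l) a b c d = deriv (legP l) (sphH a b c d) *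
      (v₁ c d * (sin b * sin d * sin (a - c)) +
        v₂ c d * (sin b * cos d * cos (a - c) - cos b * sin d)) := by
  have hp := (differentiable_legP l (sphH a b c d)).hasDerivAt
  have h₁ : pθy (PH l) a b c d = _ := (hp.comp c (hasDerivAt_sphH_θy a b c d)).deriv
  have h₂ : pφy (PH l) a b c d = _ := (hp.comp d (hasDerivAt_sphH_φy a b c d)).deriv
  rw [Vy, h₁, h₂]
  ring

theorem pθx_Vy_PH_diagonal (v₁ v₂ : ℝ → ℝ → ℝ) (l : ℕ) (θ φ : ℝ) :
    pθx (Vy v₁ v₂ (PH l)) θ φ θ φ = deriv (legP l) 1 * (v₁ θ φ * sin φ ^ 2) := by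
  simp only [pθx, Vy_PH]
  have hs : DifferentiableAt ℝ (fun t => sphH t φ θ φ) θ := by unfold sphH; fun_prop
  have hp := ((differentiable_deriv_legP l (sphH θ φ θ φ)).hasDerivAt).comp θ hs.hasDerivAt
  have hd := (hasDerivAt_id θ).sub_const θ
  have hA := ((hd.sin.const_mul (sin φ * sin φ)).const_mul (v₁ θ φ)).add
    (((hd.cos.const_mul (sin φ * cos φ)).sub_const (cos φ * sin φ)).const_mul (v₂ θ φ))
  refine (hp.mul hA).deriv.trans ?_
  simp [sphH_diagonal]
  ring

theorem pφx_Vy_PH_diagonal (v₁ v₂ : ℝ → ℝ → ℝ) (l : ℕ) (θ φ : ℝ) :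
    pφx (Vy v₁ v₂ (PH l)) θ φ θ φ = deriv (legP l) 1 * v₂ θ φ := by
  simp only [pφx, Vy_PH]
  have hs : DifferentiableAt ℝ (fun t => sphH θ t θ φ) φ := by unfold sphH; fun_prop
  have hp := HasDerivAt.comp (h := fun t => sphH θ t θ φ) φ
    (differentiable_deriv_legP l (sphH θ φ θ φ)).hasDerivAt hs.hasDerivAt
  have hA := ((((hasDerivAt_sin φ).mul_const (sin φ)).mul_const (sin (θ - θ))).const_mul
    (v₁ θ φ)).add (((((hasDerivAt_sin φ).mul_const (cos φ)).mul_const (cos (θ - θ))).sub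
      ((hasDerivAt_cos φ).mul_const (sin φ))).const_mul (v₂ θ φ))
  refine (hp.mul hA).deriv.trans ?_
  simp [sphH_diagonal]
  linear_combination deriv (legP l) 1 * v₂ θ φ * cos_sq_add_sin_sq φ

/-- `V_x V_y P_l(h)` on the diagonal equals `‖V‖² P_l'(1)`. -/
theorem VxVy_on_diagonal
    (v₁ v₂ : ℝ → ℝ → ℝ)
    (hv₁ : ContDiff ℝ (⊤ : ℕ∞) (Function.uncurry v₁)) (hv₂ : ContDiff ℝ (⊤ : ℕ∞) (Function.uncurry v₂))
    (l : ℕ) (θ φ : ℝ) (hφ : φ ∈ Set.Ioo 0 π) :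
    Vx v₁ v₂ (Vy v₁ v₂ (PH l)) θ φ θ φ =
      ((Real.sin φ) ^ 2 * (v₁ θ φ) ^ 2 + (v₂ θ φ) ^ 2) * deriv (legP l) 1 := by
  rw [Vx, pθx_Vy_PH_diagonal, pφx_Vy_PH_diagonal]
  ring
end

section
/- At every (θ, φ) with φ ∈ (0, π) and ‖V‖(θ, φ) ≠ 0, the conditional covariance matrix Δ_l(θ, φ) has entries (Δ_l)₁₁ = ‖V^⊥‖²(θ, φ) (l² + l)/2 and (Δ_l)₁₂ = (Δ_l)₂₁ = ã₃₄(θ, φ) (l² + l)/2, where ã₃₄ = v₂ v₁ (∂v₁/∂θ) sin²φ + 2 v₂² v₁ sinφ cosφ + v₂² (∂v₁/∂φ) sin²φ + v₁³ cosφ sin³φ − v₁² (∂v₂/∂θ) sin²φ − v₁ v₂ (∂v₂/∂φ) sin²φ, and there is a constant C_V depending only on v₁, v₂ and their first derivatives such that |(Δ_l)₂₂ − ‖V‖⁴(θ, φ)(l⁴/8 + l³/4)| ≤ C_V (1 + ‖V‖(θ, φ)^{−2}) l² for all l ∈ ℕ. -/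
open Real

/-- `‖V‖²(θ,φ) = sin²(φ) v₁(θ,φ)² + v₂(θ,φ)²`. -/
noncomputable def nV2 (v₁ v₂ : ℝ → ℝ → ℝ) (θ φ : ℝ) : ℝ :=
  (Real.sin φ) ^ 2 * (v₁ θ φ) ^ 2 + (v₂ θ φ) ^ 2

/-- The operators `D₁ = id`, `D₂ = V`, `D₃ = V^⊥`, `D₄ = VV`, acting in the `x`-variables. -/
noncomputable def Dx4 (v₁ v₂ : ℝ → ℝ → ℝ) : Fin 4 → F4 → F4 :=
  ![id, Vx v₁ v₂, Vxp v₁ v₂, fun f => Vx v₁ v₂ (Vx v₁ v₂ f)]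

/-- The operators `D₁ = id`, `D₂ = V`, `D₃ = V^⊥`, `D₄ = VV`, acting in the `y`-variables. -/
noncomputable def Dy4 (v₁ v₂ : ℝ → ℝ → ℝ) : Fin 4 → F4 → F4 :=
  ![id, Vy v₁ v₂, Vyp v₁ v₂, fun f => Vy v₁ v₂ (Vy v₁ v₂ f)]

/-- The full 4×4 covariance matrix `A_l(θ,φ)`, with `(i,j)` entry
`D_i^x D_j^y P_l(h)` evaluated on the diagonal. -/
noncomputable def Amat (v₁ v₂ : ℝ → ℝ → ℝ) (l : ℕ) (θ φ : ℝ) : Matrix (Fin 4) (Fin 4) ℝ :=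
  Matrix.of fun i j => Dx4 v₁ v₂ i (Dy4 v₁ v₂ j (PH l)) θ φ θ φ

/-- Top-left 2×2 block `C₁₁` of `A_l`. -/
noncomputable def C11m (v₁ v₂ : ℝ → ℝ → ℝ) (l : ℕ) (θ φ : ℝ) : Matrix (Fin 2) (Fin 2) ℝ :=
  !![Amat v₁ v₂ l θ φ 0 0, Amat v₁ v₂ l θ φ 0 1;
     Amat v₁ v₂ l θ φ 1 0, Amat v₁ v₂ l θ φ 1 1]

/-- Top-right 2×2 block `C₁₂` of `A_l`. -/
noncomputable def C12m (v₁ v₂ : ℝ → ℝ → ℝ) (l : ℕ) (θ φ : ℝ) : Matrix (Fin 2) (Fin 2) ℝ :=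
  !![Amat v₁ v₂ l θ φ 0 2, Amat v₁ v₂ l θ φ 0 3;
     Amat v₁ v₂ l θ φ 1 2, Amat v₁ v₂ l θ φ 1 3]

/-- Bottom-left 2×2 block `C₂₁` of `A_l`. -/
noncomputable def C21m (v₁ v₂ : ℝ → ℝ → ℝ) (l : ℕ) (θ φ : ℝ) : Matrix (Fin 2) (Fin 2) ℝ :=
  !![Amat v₁ v₂ l θ φ 2 0, Amat v₁ v₂ l θ φ 2 1;
     Amat v₁ v₂ l θ φ 3 0, Amat v₁ v₂ l θ φ 3 1]

/-- Bottom-right 2×2 block `C₂₂` of `A_l`. -/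
noncomputable def C22m (v₁ v₂ : ℝ → ℝ → ℝ) (l : ℕ) (θ φ : ℝ) : Matrix (Fin 2) (Fin 2) ℝ :=
  !![Amat v₁ v₂ l θ φ 2 2, Amat v₁ v₂ l θ φ 2 3;
     Amat v₁ v₂ l θ φ 3 2, Amat v₁ v₂ l θ φ 3 3]

/-- The conditional covariance matrix `Δ_l(θ,φ) = C₂₂ − C₂₁ C₁₁⁻¹ C₁₂`. -/
noncomputable def Dmat (v₁ v₂ : ℝ → ℝ → ℝ) (l : ℕ) (θ φ : ℝ) : Matrix (Fin 2) (Fin 2) ℝ :=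
  C22m v₁ v₂ l θ φ - C21m v₁ v₂ l θ φ * (C11m v₁ v₂ l θ φ)⁻¹ * C12m v₁ v₂ l θ φ

section Legendre

open Polynomial

lemma iteratedDeriv_polynomial_eval (n : ℕ) (p : ℝ[X]) :
    iteratedDeriv n (fun x => p.eval x) = fun x => (derivative^[n] p).eval x := by
  induction n generalizing p with
  | zero => simp
  | succ k ih =>
    rw [iteratedDeriv_succ', Function.iterate_succ_apply, ← ih]
    congr 1
    ext x
    simp

lemma iterate_derivative_comp_affine (n : ℕ) (p : ℝ[X]) (a b : ℝ) :
    derivative^[n] (p.comp (C a + C b * X)) =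
      C b ^ n * (derivative^[n] p).comp (C a + C b * X) := by
  induction n generalizing p with
  | zero => simp
  | succ k ih =>
    rw [Function.iterate_succ_apply, derivative_comp, Function.iterate_succ_apply]
    simp only [derivative_add, derivative_C, derivative_mul, derivative_X, zero_mul, zero_add,
      mul_one]
    rw [iterate_derivative_C_mul, ih]
    ring

/-- The degree-`l` Legendre polynomial as an affine substitution in the shifted one. -/
noncomputable def legPoly (l : ℕ) : ℝ[X] :=
  ((shiftedLegendre l).map (Int.castRingHom ℝ)).comp (C (1 / 2) + C (-1 / 2) * X)

lemma legP_eq_eval (l : ℕ) : legP l = fun t => (legPoly l).eval t := by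
  have hfac := congrArg (Polynomial.map (Int.castRingHom ℝ)) (factorial_mul_shiftedLegendre_eq l)
  rw [← iterate_derivative_map] at hfac
  simp only [Polynomial.map_mul, Polynomial.map_natCast, Polynomial.map_pow, Polynomial.map_X,
    Polynomial.map_sub, Polynomial.map_one] at hfac
  have hpoly : ((X : ℝ[X]) ^ 2 - 1) ^ l =
      C ((-4) ^ l) * ((X ^ l * (1 - X) ^ l : ℝ[X]).comp (C (1 / 2) + C (-1 / 2) * X)) := by
    simp only [mul_comp, pow_comp, sub_comp, X_comp, one_comp, C_pow, ← mul_pow]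
    congr 1
    refine Polynomial.funext fun x => ?_
    simp
    ring
  have hfun : (fun s : ℝ => (s ^ 2 - 1) ^ l) = fun s => (((X : ℝ[X]) ^ 2 - 1) ^ l).eval s := by
    ext s; simp
  ext t
  have hl : (l.factorial : ℝ) ≠ 0 := by positivity
  rw [legP, hfun, iteratedDeriv_polynomial_eval, hpoly, iterate_derivative_C_mul,
    iterate_derivative_comp_affine, ← hfac, legPoly]
  simp only [eval_mul, eval_C, eval_pow, mul_comp, natCast_comp, eval_natCast]
  have h4 : ((-4 : ℝ)) ^ l * (-1 / 2) ^ l = 2 ^ l := by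
    rw [← mul_pow]; norm_num
  generalize eval t (((shiftedLegendre l).map (Int.castRingHom ℝ)).comp
    (C (1 / 2) + C (-1 / 2) * X)) = y
  rw [← mul_assoc ((-4 : ℝ) ^ l), h4]
  field_simp

lemma legPoly_eval_one (l : ℕ) : (legPoly l).eval 1 = 1 := by
  rw [legPoly, eval_comp]
  norm_num
  rw [← coeff_zero_eq_eval_zero, coeff_shiftedLegendre]
  simp

lemma legPoly_derivative_eval_one (l : ℕ) :
    (derivative (legPoly l)).eval 1 = ((l : ℝ) ^ 2 + l) / 2 := by
  rw [legPoly, derivative_comp]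
  simp only [derivative_add, derivative_C, derivative_mul, derivative_X, eval_mul, eval_comp]
  norm_num
  rw [← coeff_zero_eq_eval_zero, coeff_derivative, coeff_shiftedLegendre]
  simp
  ring

lemma legPoly_derivative_two_eval_one (l : ℕ) :
    (derivative (derivative (legPoly l))).eval 1 =
      (l - 1) * l * (l + 1) * (l + 2) / 8 := by
  rw [legPoly, derivative_comp]
  simp only [derivative_add, derivative_C, derivative_mul, derivative_X, derivative_comp,
    eval_add, eval_mul, eval_comp]
  norm_num
  rw [← coeff_zero_eq_eval_zero, coeff_derivative, coeff_derivative,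
    coeff_shiftedLegendre]
  have h : (l + 2).choose l = (l + 2).choose 2 := by
    rw [← Nat.choose_symm_add]
  simp [h, Nat.cast_choose_two]
  ring

end Legendre

section Calculus

/-- Joint smoothness of a function of the four variables. -/
def Smooth4 (f : F4) : Prop :=
  ContDiff ℝ (⊤ : ℕ∞) fun z : ℝ × ℝ × ℝ × ℝ => f z.1 z.2.1 z.2.2.1 z.2.2.2

/-- Joint smoothness of a function of two variables. -/
abbrev Smooth2 (u : ℝ → ℝ → ℝ) : Prop := ContDiff ℝ (⊤ : ℕ∞) (Function.uncurry u)

lemma Smooth4.differentiableAt_fst {f : F4} (hf : Smooth4 f) (a b c d : ℝ) :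
    DifferentiableAt ℝ (fun t => f t b c d) a := by
  have h : ContDiff ℝ (⊤ : ℕ∞) fun t : ℝ => f t b c d :=
    ContDiff.comp (g := fun z : ℝ × ℝ × ℝ × ℝ => f z.1 z.2.1 z.2.2.1 z.2.2.2) hf
      (f := fun t : ℝ => (t, b, c, d)) (by fun_prop)
  exact h.differentiable (by simp) a

lemma Smooth4.differentiableAt_snd {f : F4} (hf : Smooth4 f) (a b c d : ℝ) :
    DifferentiableAt ℝ (fun t => f a t c d) b := by
  have h : ContDiff ℝ (⊤ : ℕ∞) fun t : ℝ => f a t c d :=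
    ContDiff.comp (g := fun z : ℝ × ℝ × ℝ × ℝ => f z.1 z.2.1 z.2.2.1 z.2.2.2) hf
      (f := fun t : ℝ => (a, t, c, d)) (by fun_prop)
  exact h.differentiable (by simp) b

lemma Smooth2.differentiableAt_fst {u : ℝ → ℝ → ℝ} (hu : Smooth2 u) (a b : ℝ) :
    DifferentiableAt ℝ (fun t => u t b) a := by
  have h : ContDiff ℝ (⊤ : ℕ∞) fun t : ℝ => u t b :=
    ContDiff.comp (g := Function.uncurry u) hu (f := fun t : ℝ => (t, b)) (by fun_prop)
  exact h.differentiable (by simp) a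

lemma Smooth2.differentiableAt_snd {u : ℝ → ℝ → ℝ} (hu : Smooth2 u) (a b : ℝ) :
    DifferentiableAt ℝ (fun t => u a t) b := by
  have h : ContDiff ℝ (⊤ : ℕ∞) fun t : ℝ => u a t :=
    ContDiff.comp (g := Function.uncurry u) hu (f := fun t : ℝ => (a, t)) (by fun_prop)
  exact h.differentiable (by simp) b

lemma Smooth2.deriv_fst {u : ℝ → ℝ → ℝ} (hu : Smooth2 u) :
    Smooth2 fun a b => deriv (fun t => u t b) a := by
  have h : (Function.uncurry fun a b => deriv (fun t => u t b) a) =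
      fun z => fderiv ℝ (Function.uncurry u) z (1, 0) := by
    ext ⟨a, b⟩
    have h1 : HasFDerivAt (Function.uncurry u) (fderiv ℝ (Function.uncurry u) (a, b)) (a, b) :=
      (hu.differentiable (by simp) (a, b)).hasFDerivAt
    exact (h1.comp_hasDerivAt (f := fun t : ℝ => (t, b)) a
      ((hasDerivAt_id a).prodMk (hasDerivAt_const a b))).deriv
  rw [Smooth2, h]
  exact (hu.fderiv_right (by simp)).clm_apply contDiff_const

lemma Smooth2.deriv_snd {u : ℝ → ℝ → ℝ} (hu : Smooth2 u) :
    Smooth2 fun a b => deriv (fun t => u a t) b := by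
  have h : (Function.uncurry fun a b => deriv (fun t => u a t) b) =
      fun z => fderiv ℝ (Function.uncurry u) z (0, 1) := by
    ext ⟨a, b⟩
    have h1 : HasFDerivAt (Function.uncurry u) (fderiv ℝ (Function.uncurry u) (a, b)) (a, b) :=
      (hu.differentiable (by simp) (a, b)).hasFDerivAt
    exact (h1.comp_hasDerivAt (f := fun t : ℝ => (a, t)) b
      ((hasDerivAt_const b a).prodMk (hasDerivAt_id b))).deriv
  rw [Smooth2, h]
  exact (hu.fderiv_right (by simp)).clm_apply contDiff_const

/-- The operator `p ∂/∂θ_x + q ∂/∂φ_x`. -/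
noncomputable def fieldX (p q : ℝ → ℝ → ℝ) (f : F4) : F4 :=
  fun a b c d => p a b * pθx f a b c d + q a b * pφx f a b c d

/-- The operator `p ∂/∂θ_y + q ∂/∂φ_y`. -/
noncomputable def fieldY (p q : ℝ → ℝ → ℝ) (f : F4) : F4 :=
  fun a b c d => p c d * pθy f a b c d + q c d * pφy f a b c d

/-- The derivation `p ∂/∂θ + q ∂/∂φ` applied componentwise to a map into `ℝ³`. -/
noncomputable def field2 (p q : ℝ → ℝ → ℝ) (u : Fin 3 → ℝ → ℝ → ℝ) : Fin 3 → ℝ → ℝ → ℝ :=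
  fun i a b => p a b * deriv (fun t => u i t b) a + q a b * deriv (fun t => u i a t) b

/-- The function `⟪u(θ_x, φ_x), w(θ_y, φ_y)⟫` of the four variables. -/
def pairing (u w : Fin 3 → ℝ → ℝ → ℝ) : F4 := fun a b c d => ∑ i, u i a b * w i c d

lemma Smooth2.field2 {p q : ℝ → ℝ → ℝ} {u : Fin 3 → ℝ → ℝ → ℝ} (hp : Smooth2 p) (hq : Smooth2 q)
    (hu : ∀ i, Smooth2 (u i)) (i : Fin 3) : Smooth2 (field2 p q u i) :=
  (hp.mul (hu i).deriv_fst).add (hq.mul (hu i).deriv_snd)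

lemma Smooth4.pairing {u w : Fin 3 → ℝ → ℝ → ℝ} (hu : ∀ i, Smooth2 (u i))
    (hw : ∀ i, Smooth2 (w i)) : Smooth4 (pairing u w) := by
  refine ContDiff.sum fun i _ => ContDiff.mul ?_ ?_
  · exact (hu i).comp (f := fun z : ℝ × ℝ × ℝ × ℝ => (z.1, z.2.1)) (by fun_prop)
  · exact (hw i).comp (f := fun z : ℝ × ℝ × ℝ × ℝ => (z.2.2.1, z.2.2.2)) (by fun_prop)

lemma Smooth4.add {f g : F4} (hf : Smooth4 f) (hg : Smooth4 g) : Smooth4 (f + g) :=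
  ContDiff.add hf hg

lemma Smooth4.mul {f g : F4} (hf : Smooth4 f) (hg : Smooth4 g) : Smooth4 (f * g) :=
  ContDiff.mul hf hg

/-- Composition of a polynomial with a function of the four variables. -/
noncomputable def polyComp (P : Polynomial ℝ) (f : F4) : F4 := fun a b c d => P.eval (f a b c d)

lemma Smooth4.polyComp {f : F4} (hf : Smooth4 f) (P : Polynomial ℝ) : Smooth4 (polyComp P f) :=
  ContDiff.comp (g := fun x => P.eval x) (by simpa using P.contDiff_aeval (𝕜 := ℝ) _) hf

variable {p q : ℝ → ℝ → ℝ} {f g : F4}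

lemma fieldX_add (hf : Smooth4 f) (hg : Smooth4 g) :
    fieldX p q (f + g) = fieldX p q f + fieldX p q g := by
  funext a b c d
  simp only [fieldX, pθx, pφx, Pi.add_apply]
  rw [deriv_fun_add (hf.differentiableAt_fst ..) (hg.differentiableAt_fst ..),
    deriv_fun_add (hf.differentiableAt_snd ..) (hg.differentiableAt_snd ..)]
  ring

lemma fieldX_mul (hf : Smooth4 f) (hg : Smooth4 g) :
    fieldX p q (f * g) = fieldX p q f * g + f * fieldX p q g := by
  funext a b c d
  simp only [fieldX, pθx, pφx, Pi.add_apply, Pi.mul_apply]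
  rw [deriv_fun_mul (hf.differentiableAt_fst ..) (hg.differentiableAt_fst ..),
    deriv_fun_mul (hf.differentiableAt_snd ..) (hg.differentiableAt_snd ..)]
  ring

lemma fieldX_polyComp (hf : Smooth4 f) (P : Polynomial ℝ) :
    fieldX p q (polyComp P f) = polyComp (Polynomial.derivative P) f * fieldX p q f := by
  funext a b c d
  simp only [fieldX, pθx, pφx, Pi.mul_apply, polyComp]
  have h1 := ((P.hasDerivAt _).comp a (hf.differentiableAt_fst a b c d).hasDerivAt).deriv
  have h2 := ((P.hasDerivAt _).comp b (hf.differentiableAt_snd a b c d).hasDerivAt).deriv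
  simp only [Function.comp_def] at h1 h2
  rw [h1, h2]
  ring

lemma fieldX_pairing {u w : Fin 3 → ℝ → ℝ → ℝ} (hu : ∀ i, Smooth2 (u i)) :
    fieldX p q (pairing u w) = pairing (field2 p q u) w := by
  funext a b c d
  simp only [fieldX, pθx, pφx, pairing, field2]
  rw [deriv_fun_sum fun i _ => ((hu i).differentiableAt_fst a b).mul_const _,
    deriv_fun_sum fun i _ => ((hu i).differentiableAt_snd a b).mul_const _,
    Finset.mul_sum, Finset.mul_sum, ← Finset.sum_add_distrib]
  refine Finset.sum_congr rfl fun i _ => ?_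
  rw [deriv_mul_const ((hu i).differentiableAt_fst a b),
    deriv_mul_const ((hu i).differentiableAt_snd a b)]
  ring

/-- Exchange of the `x`- and `y`-variables. -/
def swap4 (f : F4) : F4 := fun a b c d => f c d a b

lemma Smooth4.swap4 (hf : Smooth4 f) : Smooth4 (swap4 f) :=
  ContDiff.comp (g := fun z : ℝ × ℝ × ℝ × ℝ => f z.1 z.2.1 z.2.2.1 z.2.2.2) hf
    (f := fun z : ℝ × ℝ × ℝ × ℝ => (z.2.2.1, z.2.2.2, z.1, z.2.1)) (by fun_prop)

lemma fieldY_eq_swap4 : fieldY p q f = swap4 (fieldX p q (swap4 f)) := rfl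

lemma fieldY_add (hf : Smooth4 f) (hg : Smooth4 g) :
    fieldY p q (f + g) = fieldY p q f + fieldY p q g :=
  congrArg swap4 (fieldX_add hf.swap4 hg.swap4)

lemma fieldY_mul (hf : Smooth4 f) (hg : Smooth4 g) :
    fieldY p q (f * g) = fieldY p q f * g + f * fieldY p q g :=
  congrArg swap4 (fieldX_mul hf.swap4 hg.swap4)

lemma fieldY_polyComp (hf : Smooth4 f) (P : Polynomial ℝ) :
    fieldY p q (polyComp P f) = polyComp (Polynomial.derivative P) f * fieldY p q f :=
  congrArg swap4 (fieldX_polyComp hf.swap4 P)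

lemma pairing_swap4 (u w : Fin 3 → ℝ → ℝ → ℝ) : swap4 (pairing u w) = pairing w u := by
  funext a b c d
  simp only [swap4, pairing, mul_comm]

lemma fieldY_pairing {u w : Fin 3 → ℝ → ℝ → ℝ} (hw : ∀ i, Smooth2 (w i)) :
    fieldY p q (pairing u w) = pairing u (field2 p q w) := by
  rw [fieldY_eq_swap4, pairing_swap4, fieldX_pairing hw, pairing_swap4]

end Calculus

section Covariance

variable {p q r s : ℝ → ℝ → ℝ} {u : Fin 3 → ℝ → ℝ → ℝ} (P : Polynomial ℝ)

open Polynomial in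
lemma fieldX_polyComp_pairing (hu : ∀ i, Smooth2 (u i)) :
    fieldX p q (polyComp P (pairing u u)) =
      polyComp (derivative P) (pairing u u) * pairing (field2 p q u) u := by
  rw [fieldX_polyComp (Smooth4.pairing hu hu), fieldX_pairing hu]

open Polynomial in
lemma fieldY_polyComp_pairing (hu : ∀ i, Smooth2 (u i)) :
    fieldY p q (polyComp P (pairing u u)) =
      polyComp (derivative P) (pairing u u) * pairing u (field2 p q u) := by
  rw [fieldY_polyComp (Smooth4.pairing hu hu), fieldY_pairing hu]

open Polynomial in
lemma fieldX_fieldX_polyComp_pairing (hp : Smooth2 p) (hq : Smooth2 q) (hu : ∀ i, Smooth2 (u i)) :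
    fieldX p q (fieldX p q (polyComp P (pairing u u))) =
      polyComp (derivative (derivative P)) (pairing u u) *
          pairing (field2 p q u) u * pairing (field2 p q u) u +
        polyComp (derivative P) (pairing u u) * pairing (field2 p q (field2 p q u)) u := by
  have hU := Smooth2.field2 hp hq hu
  rw [fieldX_polyComp_pairing P hu,
    fieldX_mul ((Smooth4.pairing hu hu).polyComp _) (Smooth4.pairing hU hu),
    fieldX_polyComp_pairing _ hu, fieldX_pairing hU]

open Polynomial in
lemma fieldY_fieldY_polyComp_pairing (hp : Smooth2 p) (hq : Smooth2 q) (hu : ∀ i, Smooth2 (u i)) :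
    fieldY p q (fieldY p q (polyComp P (pairing u u))) =
      polyComp (derivative (derivative P)) (pairing u u) *
          pairing u (field2 p q u) * pairing u (field2 p q u) +
        polyComp (derivative P) (pairing u u) * pairing u (field2 p q (field2 p q u)) := by
  have hU := Smooth2.field2 hp hq hu
  rw [fieldY_polyComp_pairing P hu,
    fieldY_mul ((Smooth4.pairing hu hu).polyComp _) (Smooth4.pairing hu hU),
    fieldY_polyComp_pairing _ hu, fieldY_pairing hU]

open Polynomial in
lemma fieldX_fieldY_diag (hr : Smooth2 r) (hs : Smooth2 s)
    (hu : ∀ i, Smooth2 (u i)) {θ φ : ℝ}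
    (h1 : pairing u u θ φ θ φ = 1) (hU : pairing (field2 p q u) u θ φ θ φ = 0) :
    fieldX p q (fieldY r s (polyComp P (pairing u u))) θ φ θ φ =
      (derivative P).eval 1 * pairing (field2 p q u) (field2 r s u) θ φ θ φ := by
  have hE := Smooth2.field2 hr hs hu
  rw [fieldY_polyComp_pairing P hu,
    fieldX_mul ((Smooth4.pairing hu hu).polyComp _) (Smooth4.pairing hu hE),
    fieldX_polyComp_pairing _ hu, fieldX_pairing hu]
  simp only [Pi.add_apply, Pi.mul_apply, polyComp, h1, hU]
  ring

open Polynomial in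
lemma fieldX_fieldY_fieldY_diag (hr : Smooth2 r) (hs : Smooth2 s)
    (hu : ∀ i, Smooth2 (u i)) {θ φ : ℝ}
    (h1 : pairing u u θ φ θ φ = 1) (hU : pairing (field2 p q u) u θ φ θ φ = 0)
    (hE : pairing u (field2 r s u) θ φ θ φ = 0) :
    fieldX p q (fieldY r s (fieldY r s (polyComp P (pairing u u)))) θ φ θ φ =
      (derivative P).eval 1 * pairing (field2 p q u) (field2 r s (field2 r s u)) θ φ θ φ := by
  have sE := Smooth2.field2 hr hs hu
  have sEE := Smooth2.field2 hr hs sE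
  have sH := Smooth4.pairing hu hu
  have s1 := Smooth4.pairing hu sE
  have s2 := Smooth4.pairing hu sEE
  rw [fieldY_fieldY_polyComp_pairing P hr hs hu,
    fieldX_add (((sH.polyComp _).mul s1).mul s1) ((sH.polyComp _).mul s2),
    fieldX_mul ((sH.polyComp _).mul s1) s1, fieldX_mul (sH.polyComp _) s1,
    fieldX_mul (sH.polyComp _) s2, fieldX_polyComp_pairing _ hu, fieldX_polyComp_pairing _ hu,
    fieldX_pairing hu, fieldX_pairing hu]
  simp only [Pi.add_apply, Pi.mul_apply, polyComp, h1, hU, hE]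
  ring

open Polynomial in
lemma fieldX_fieldX_fieldY_diag (hp : Smooth2 p) (hq : Smooth2 q) (hr : Smooth2 r)
    (hs : Smooth2 s) (hu : ∀ i, Smooth2 (u i)) {θ φ : ℝ}
    (h1 : pairing u u θ φ θ φ = 1) (hU : pairing (field2 p q u) u θ φ θ φ = 0)
    (hE : pairing u (field2 r s u) θ φ θ φ = 0) :
    fieldX p q (fieldX p q (fieldY r s (polyComp P (pairing u u)))) θ φ θ φ =
      (derivative P).eval 1 * pairing (field2 p q (field2 p q u)) (field2 r s u) θ φ θ φ := by
  have sE := Smooth2.field2 hr hs hu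
  have sU := Smooth2.field2 hp hq hu
  have sH := Smooth4.pairing hu hu
  have s1 := Smooth4.pairing hu sE
  rw [fieldY_polyComp_pairing P hu,
    fieldX_mul (sH.polyComp _) s1, fieldX_polyComp_pairing _ hu, fieldX_pairing hu,
    fieldX_add (((sH.polyComp _).mul (Smooth4.pairing sU hu)).mul s1)
      ((sH.polyComp _).mul (Smooth4.pairing sU sE)),
    fieldX_mul ((sH.polyComp _).mul (Smooth4.pairing sU hu)) s1,
    fieldX_mul (sH.polyComp _) (Smooth4.pairing sU sE), fieldX_polyComp_pairing _ hu,
    fieldX_pairing hu, fieldX_pairing sU]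
  simp only [Pi.add_apply, Pi.mul_apply, polyComp, h1, hU, hE]
  ring

open Polynomial in
lemma fieldX_fieldX_fieldY_fieldY_diag (hp : Smooth2 p) (hq : Smooth2 q) (hr : Smooth2 r)
    (hs : Smooth2 s) (hu : ∀ i, Smooth2 (u i)) {θ φ : ℝ}
    (h1 : pairing u u θ φ θ φ = 1) (hU : pairing (field2 p q u) u θ φ θ φ = 0)
    (hE : pairing u (field2 r s u) θ φ θ φ = 0) :
    fieldX p q (fieldX p q (fieldY r s (fieldY r s (polyComp P (pairing u u))))) θ φ θ φ =
      (derivative P).eval 1 *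
          pairing (field2 p q (field2 p q u)) (field2 r s (field2 r s u)) θ φ θ φ +
        (derivative (derivative P)).eval 1 *
          (pairing (field2 p q (field2 p q u)) u θ φ θ φ *
              pairing u (field2 r s (field2 r s u)) θ φ θ φ +
            2 * pairing (field2 p q u) (field2 r s u) θ φ θ φ ^ 2) := by
  have sE := Smooth2.field2 hr hs hu
  have sEE := Smooth2.field2 hr hs sE
  have sU := Smooth2.field2 hp hq hu
  have sH := Smooth4.pairing hu hu
  have s1 := Smooth4.pairing hu sE
  have s2 := Smooth4.pairing hu sEE
  have s3 := Smooth4.pairing sU hu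
  have s4 := Smooth4.pairing sU sE
  have s5 := Smooth4.pairing sU sEE
  rw [fieldY_fieldY_polyComp_pairing P hr hs hu,
    fieldX_add (((sH.polyComp _).mul s1).mul s1) ((sH.polyComp _).mul s2),
    fieldX_mul ((sH.polyComp _).mul s1) s1, fieldX_mul (sH.polyComp _) s1,
    fieldX_mul (sH.polyComp _) s2, fieldX_polyComp_pairing _ hu, fieldX_polyComp_pairing _ hu,
    fieldX_pairing hu, fieldX_pairing hu]
  have sP (Q : Polynomial ℝ) := sH.polyComp Q
  have t1 (Q : Polynomial ℝ) := ((sP Q).mul s3).mul s1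
  have t2 (Q : Polynomial ℝ) := (sP Q).mul s4
  have t3 (Q : Polynomial ℝ) := ((sP Q).mul s1).mul s4
  have t4 (Q : Polynomial ℝ) := ((sP Q).mul s3).mul s2
  have t5 (Q : Polynomial ℝ) := (sP Q).mul s5
  rw [fieldX_add ((((t1 _).add (t2 _)).mul s1).add (t3 _)) ((t4 _).add (t5 _)),
    fieldX_add (((t1 _).add (t2 _)).mul s1) (t3 _), fieldX_add (t4 _) (t5 _),
    fieldX_mul ((t1 _).add (t2 _)) s1, fieldX_add (t1 _) (t2 _),
    fieldX_mul ((sP _).mul s3) s1, fieldX_mul ((sP _).mul s1) s4,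
    fieldX_mul ((sP _).mul s3) s2, fieldX_mul (sP _) s5, fieldX_mul (sP _) s4,
    fieldX_mul (sP _) s1]
  simp only [fieldX_mul (sP _) s3, fieldX_pairing hu, fieldX_pairing sU, fieldX_polyComp_pairing _ hu]
  simp only [Pi.add_apply, Pi.mul_apply, polyComp, h1, hU, hE]
  ring

end Covariance

section Sphere

/-- The embedding of the unit sphere in `ℝ³` in spherical coordinates. -/
noncomputable def sphereEmb : Fin 3 → ℝ → ℝ → ℝ :=
  ![fun a b => Real.sin b * Real.cos a, fun a b => Real.sin b * Real.sin a, fun _ b => Real.cos b]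

lemma smooth2_sphereEmb (i : Fin 3) : Smooth2 (sphereEmb i) := by
  fin_cases i
  · exact (Real.contDiff_sin.comp contDiff_snd).mul (Real.contDiff_cos.comp contDiff_fst)
  · exact (Real.contDiff_sin.comp contDiff_snd).mul (Real.contDiff_sin.comp contDiff_fst)
  · exact Real.contDiff_cos.comp contDiff_snd

lemma sphH_eq_pairing : sphH = pairing sphereEmb sphereEmb := by
  funext a b c d
  simp only [sphH, pairing, sphereEmb, Fin.sum_univ_three, Matrix.cons_val, Real.cos_sub]
  ring

lemma PH_eq_polyComp (l : ℕ) : PH l = polyComp (legPoly l) (pairing sphereEmb sphereEmb) := by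
  funext a b c d
  rw [PH, legP_eq_eval, sphH_eq_pairing, polyComp]

lemma field2_sphereEmb (p q : ℝ → ℝ → ℝ) :
    field2 p q sphereEmb =
      ![fun a b => p a b * (-(Real.sin b * Real.sin a)) + q a b * (Real.cos b * Real.cos a),
        fun a b => p a b * (Real.sin b * Real.cos a) + q a b * (Real.cos b * Real.sin a),
        fun a b => -(q a b * Real.sin b)] := by
  funext i a b
  fin_cases i <;> simp [field2, sphereEmb]

lemma field2_field2_sphereEmb {p q : ℝ → ℝ → ℝ} (hp : Smooth2 p) (hq : Smooth2 q) (a b : ℝ) :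
    (fun i => field2 p q (field2 p q sphereEmb) i a b) =
      let T₁ := p a b * deriv (fun t => p t b) a + q a b * deriv (fun t => p a t) b
      let T₂ := p a b * deriv (fun t => q t b) a + q a b * deriv (fun t => q a t) b
      ![T₁ * (-(Real.sin b * Real.sin a)) + T₂ * (Real.cos b * Real.cos a) -
          p a b ^ 2 * (Real.sin b * Real.cos a) - 2 * p a b * q a b * (Real.cos b * Real.sin a) -
          q a b ^ 2 * (Real.sin b * Real.cos a),
        T₁ * (Real.sin b * Real.cos a) + T₂ * (Real.cos b * Real.sin a) -
          p a b ^ 2 * (Real.sin b * Real.sin a) + 2 * p a b * q a b * (Real.cos b * Real.cos a) -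
          q a b ^ 2 * (Real.sin b * Real.sin a),
        -(T₂ * Real.sin b) - q a b ^ 2 * Real.cos b] := by
  have p1 := (hp.differentiableAt_fst a b).hasDerivAt
  have p2 := (hp.differentiableAt_snd a b).hasDerivAt
  have q1 := (hq.differentiableAt_fst a b).hasDerivAt
  have q2 := (hq.differentiableAt_snd a b).hasDerivAt
  have sa := Real.hasDerivAt_sin a
  have sb := Real.hasDerivAt_sin b
  have ca := Real.hasDerivAt_cos a
  have cb := Real.hasDerivAt_cos b
  funext i
  rw [field2_sphereEmb]
  fin_cases i
  · have h1 := ((p1.mul (sa.const_mul (Real.sin b)).neg).add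
      (q1.mul (ca.const_mul (Real.cos b)))).deriv
    have h2 := ((p2.mul (sb.mul_const (Real.sin a)).neg).add
      (q2.mul (cb.mul_const (Real.cos a)))).deriv
    simp only [field2, Fin.zero_eta, Matrix.cons_val]
    refine (congrArg₂ (fun x y => p a b * x + q a b * y) h1 h2).trans ?_
    simp only [Pi.neg_apply]
    ring
  · have h1 := ((p1.mul (ca.const_mul (Real.sin b))).add
      (q1.mul (sa.const_mul (Real.cos b)))).deriv
    have h2 := ((p2.mul (sb.mul_const (Real.cos a))).add
      (q2.mul (cb.mul_const (Real.sin a)))).deriv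
    simp only [field2, Fin.mk_one, Matrix.cons_val]
    refine (congrArg₂ (fun x y => p a b * x + q a b * y) h1 h2).trans ?_
    ring
  · have h1 := (q1.mul_const (Real.sin b)).neg.deriv
    have h2 := (q2.mul sb).neg.deriv
    simp only [field2, Fin.reduceFinMk, Matrix.cons_val]
    refine (congrArg₂ (fun x y => p a b * x + q a b * y) h1 h2).trans ?_
    ring

lemma pairing_comm_diag (u w : Fin 3 → ℝ → ℝ → ℝ) (θ φ : ℝ) :
    pairing u w θ φ θ φ = pairing w u θ φ θ φ :=
  Finset.sum_congr rfl fun _ _ => mul_comm _ _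

lemma pairing_sphereEmb_self (θ φ : ℝ) : pairing sphereEmb sphereEmb θ φ θ φ = 1 := by
  rw [← sphH_eq_pairing, sphH, sub_self, Real.cos_zero]
  linear_combination Real.sin_sq_add_cos_sq φ

lemma pairing_field2_sphereEmb (p q : ℝ → ℝ → ℝ) (θ φ : ℝ) :
    pairing (field2 p q sphereEmb) sphereEmb θ φ θ φ = 0 := by
  rw [field2_sphereEmb]
  simp only [pairing, sphereEmb, Fin.sum_univ_three, Matrix.cons_val]
  linear_combination (q θ φ * Real.sin φ * Real.cos φ) * Real.sin_sq_add_cos_sq θ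

lemma pairing_field2_field2 (p q r s : ℝ → ℝ → ℝ) (θ φ : ℝ) :
    pairing (field2 p q sphereEmb) (field2 r s sphereEmb) θ φ θ φ =
      Real.sin φ ^ 2 * (p θ φ * r θ φ) + q θ φ * s θ φ := by
  rw [field2_sphereEmb, field2_sphereEmb]
  simp only [pairing, Fin.sum_univ_three, Matrix.cons_val]
  linear_combination (Real.sin φ ^ 2 * p θ φ * r θ φ + Real.cos φ ^ 2 * q θ φ * s θ φ) *
    Real.sin_sq_add_cos_sq θ + q θ φ * s θ φ * Real.sin_sq_add_cos_sq φ

lemma pairing_field2_field2_field2 {p q : ℝ → ℝ → ℝ} (hp : Smooth2 p) (hq : Smooth2 q)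
    (r s : ℝ → ℝ → ℝ) (θ φ : ℝ) :
    pairing (field2 r s sphereEmb) (field2 p q (field2 p q sphereEmb)) θ φ θ φ =
      r θ φ * (Real.sin φ ^ 2 *
          (p θ φ * deriv (fun t => p t φ) θ + q θ φ * deriv (fun t => p θ t) φ) +
          2 * p θ φ * q θ φ * Real.sin φ * Real.cos φ) +
        s θ φ * ((p θ φ * deriv (fun t => q t φ) θ + q θ φ * deriv (fun t => q θ t) φ) -
          p θ φ ^ 2 * Real.sin φ * Real.cos φ) := by
  have h := fun i => congrFun (field2_field2_sphereEmb hp hq θ φ) i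
  simp only [pairing, h, field2_sphereEmb r s, Fin.sum_univ_three, Matrix.cons_val]
  generalize p θ φ * deriv (fun t => p t φ) θ + q θ φ * deriv (fun t => p θ t) φ = T₁
  generalize p θ φ * deriv (fun t => q t φ) θ + q θ φ * deriv (fun t => q θ t) φ = T₂
  linear_combination (r θ φ * (Real.sin φ ^ 2 * T₁ +
      2 * p θ φ * q θ φ * Real.sin φ * Real.cos φ) +
    s θ φ * (Real.cos φ ^ 2 * T₂ - p θ φ ^ 2 * Real.sin φ * Real.cos φ -
      q θ φ ^ 2 * Real.sin φ * Real.cos φ)) * Real.sin_sq_add_cos_sq θ +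
    s θ φ * T₂ * Real.sin_sq_add_cos_sq φ

lemma pairing_sphereEmb_field2_field2 {p q : ℝ → ℝ → ℝ} (hp : Smooth2 p) (hq : Smooth2 q)
    (θ φ : ℝ) :
    pairing sphereEmb (field2 p q (field2 p q sphereEmb)) θ φ θ φ = -nV2 p q θ φ := by
  have h := fun i => congrFun (field2_field2_sphereEmb hp hq θ φ) i
  simp only [pairing, h, Fin.sum_univ_three]
  simp only [sphereEmb, Matrix.cons_val, nV2]
  generalize p θ φ * deriv (fun t => p t φ) θ + q θ φ * deriv (fun t => p θ t) φ = T₁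
  generalize p θ φ * deriv (fun t => q t φ) θ + q θ φ * deriv (fun t => q θ t) φ = T₂
  linear_combination (Real.sin φ * Real.cos φ * T₂ - p θ φ ^ 2 * Real.sin φ ^ 2 -
    q θ φ ^ 2 * Real.sin φ ^ 2) * Real.sin_sq_add_cos_sq θ -
    q θ φ ^ 2 * Real.sin_sq_add_cos_sq φ

end Sphere

section Bounds

/-- `2π`-periodicity in the first variable. -/
def PeriodicFst (u : ℝ → ℝ → ℝ) : Prop := ∀ θ φ : ℝ, u (θ + 2 * π) φ = u θ φ

lemma PeriodicFst.field2 {p q : ℝ → ℝ → ℝ} {u : Fin 3 → ℝ → ℝ → ℝ} (hp : PeriodicFst p)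
    (hq : PeriodicFst q) (hu : ∀ i, PeriodicFst (u i)) (i : Fin 3) :
    PeriodicFst (field2 p q u i) := by
  intro θ φ
  simp only [_root_.field2, hp θ φ, hq θ φ, hu i θ]
  rw [← deriv_comp_add_const]
  simp only [hu i _ φ]

lemma periodicFst_sphereEmb (i : Fin 3) : PeriodicFst (sphereEmb i) := by
  intro θ φ
  fin_cases i <;> simp [sphereEmb]

lemma exists_bound_of_periodicFst {u : ℝ → ℝ → ℝ} (hu : Continuous (Function.uncurry u))
    (hper : PeriodicFst u) : ∃ M : ℝ, ∀ θ, ∀ φ ∈ Set.Ioo 0 π, |u θ φ| ≤ M := by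
  obtain ⟨M, hM⟩ := (isCompact_Icc.prod isCompact_Icc :
    IsCompact (Set.Icc 0 (2 * π) ×ˢ Set.Icc 0 π)).exists_bound_of_continuousOn hu.continuousOn
  refine ⟨M, fun θ φ hφ => ?_⟩
  obtain ⟨y, hy, he⟩ := Function.Periodic.exists_mem_Ico₀ (f := fun t => u t φ)
    (fun t => hper t φ) Real.two_pi_pos θ
  have h := hM (y, φ) ⟨Set.Ico_subset_Icc_self hy, Set.Ioo_subset_Icc_self hφ⟩
  simpa [he] using h

lemma exists_bound_pairing_diag {u w : Fin 3 → ℝ → ℝ → ℝ} (su : ∀ i, Smooth2 (u i))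
    (sw : ∀ i, Smooth2 (w i)) (pu : ∀ i, PeriodicFst (u i)) (pw : ∀ i, PeriodicFst (w i)) :
    ∃ M : ℝ, ∀ θ, ∀ φ ∈ Set.Ioo 0 π, |pairing u w θ φ θ φ| ≤ M := by
  refine exists_bound_of_periodicFst (u := fun θ φ => pairing u w θ φ θ φ) ?_ fun θ φ => ?_
  · change Continuous fun z : ℝ × ℝ => ∑ i, Function.uncurry (u i) z * Function.uncurry (w i) z
    exact continuous_finsetSum _ fun i _ => (su i).continuous.mul (sw i).continuous
  · simp only [pairing, pu _ θ φ, pw _ θ φ]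

end Bounds

section ConditionalCovariance

lemma Vxp_eq_fieldX (v₁ v₂ : ℝ → ℝ → ℝ) :
    Vxp v₁ v₂ = fieldX v₂ fun a b => -(Real.sin b ^ 2 * v₁ a b) := by
  funext f a b c d
  simp only [Vxp, fieldX]
  ring

lemma Vyp_eq_fieldY (v₁ v₂ : ℝ → ℝ → ℝ) :
    Vyp v₁ v₂ = fieldY v₂ fun a b => -(Real.sin b ^ 2 * v₁ a b) := by
  funext f a b c d
  simp only [Vyp, fieldY]
  ring

lemma Smooth2.neg_sin_sq_mul {v : ℝ → ℝ → ℝ} (hv : Smooth2 v) :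
    Smooth2 fun a b => -(Real.sin b ^ 2 * v a b) :=
  (((Real.contDiff_sin.comp contDiff_snd).pow 2).mul hv).neg

/-- The inner product of the tangent field `V^⊥` with the second derivative `VV` of the
embedding. -/
noncomputable def perpSecond (v₁ v₂ : ℝ → ℝ → ℝ) (θ φ : ℝ) : ℝ :=
  pairing (field2 v₂ (fun a b => -(Real.sin b ^ 2 * v₁ a b)) sphereEmb)
    (field2 v₁ v₂ (field2 v₁ v₂ sphereEmb)) θ φ θ φ

/-- The inner product of the tangent field `V` with the second derivative `VV` of the
embedding. -/
noncomputable def tangSecond (v₁ v₂ : ℝ → ℝ → ℝ) (θ φ : ℝ) : ℝ :=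
  pairing (field2 v₁ v₂ sphereEmb) (field2 v₁ v₂ (field2 v₁ v₂ sphereEmb)) θ φ θ φ

/-- The squared norm of the second derivative `VV` of the embedding. -/
noncomputable def normSqSecond (v₁ v₂ : ℝ → ℝ → ℝ) (θ φ : ℝ) : ℝ :=
  pairing (field2 v₁ v₂ (field2 v₁ v₂ sphereEmb)) (field2 v₁ v₂ (field2 v₁ v₂ sphereEmb)) θ φ θ φ

lemma Amat_eq {v₁ v₂ : ℝ → ℝ → ℝ} (h₁ : Smooth2 v₁) (h₂ : Smooth2 v₂) (l : ℕ) (θ φ : ℝ) :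
    let α := ((l : ℝ) ^ 2 + l) / 2
    let β := ((l : ℝ) - 1) * l * (l + 1) * (l + 2) / 8
    let N := nV2 v₁ v₂ θ φ
    let S := perpSecond v₁ v₂ θ φ
    let T := tangSecond v₁ v₂ θ φ
    let R := normSqSecond v₁ v₂ θ φ
    Amat v₁ v₂ l θ φ =
      !![1, 0, 0, -(α * N);
         0, α * N, 0, α * T;
         0, 0, α * (Real.sin φ ^ 2 * N), α * S;
         -(α * N), α * T, α * S, α * R + 3 * β * N ^ 2] := by
  intro α β N S T R
  have su := smooth2_sphereEmb
  have sw := h₁.neg_sin_sq_mul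
  have e0 := pairing_sphereEmb_self θ φ
  have eX := fun p q => pairing_field2_sphereEmb p q θ φ
  have eY := fun p q => (pairing_comm_diag _ _ θ φ).trans (eX p q)
  have eN : pairing (field2 v₁ v₂ sphereEmb) (field2 v₁ v₂ sphereEmb) θ φ θ φ = N := by
    rw [pairing_field2_field2]; simp only [N, nV2]; ring
  have eR := pairing_sphereEmb_field2_field2 h₁ h₂ θ φ
  have eL := (pairing_comm_diag _ _ θ φ).trans eR
  have eS := pairing_comm_diag (field2 v₁ v₂ (field2 v₁ v₂ sphereEmb))
    (field2 v₂ (fun a b => -(Real.sin b ^ 2 * v₁ a b)) sphereEmb) θ φ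
  have eT := pairing_comm_diag (field2 v₁ v₂ (field2 v₁ v₂ sphereEmb))
    (field2 v₁ v₂ sphereEmb) θ φ
  have hX : Vx v₁ v₂ = fieldX v₁ v₂ := rfl
  have hY : Vy v₁ v₂ = fieldY v₁ v₂ := rfl
  have P0 := legPoly_eval_one l
  have P1 := legPoly_derivative_eval_one l
  have P2 := legPoly_derivative_two_eval_one l
  ext i j
  fin_cases i <;> fin_cases j <;>
    simp only [Amat, Dx4, Dy4, Matrix.of_apply, Matrix.cons_val, Fin.zero_eta, Fin.mk_one,
      Fin.reduceFinMk, id, hX, hY, Vxp_eq_fieldX, Vyp_eq_fieldY, PH_eq_polyComp]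
  · simp only [polyComp, e0, P0]
  · rw [fieldY_polyComp_pairing _ su]
    simp only [Pi.mul_apply, eY, mul_zero]
  · rw [fieldY_polyComp_pairing _ su]
    simp only [Pi.mul_apply, eY, mul_zero]
  · rw [fieldY_fieldY_polyComp_pairing _ h₁ h₂ su]
    simp only [Pi.add_apply, Pi.mul_apply, eY, polyComp, e0, P1, eR]
    ring
  · rw [fieldX_polyComp_pairing _ su]
    simp only [Pi.mul_apply, eX, mul_zero]
  · rw [fieldX_fieldY_diag _ h₁ h₂ su e0 (eX _ _), P1, eN]
  · rw [fieldX_fieldY_diag _ h₂ sw su e0 (eX _ _), pairing_field2_field2]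
    ring
  · rw [fieldX_fieldY_fieldY_diag _ h₁ h₂ su e0 (eX _ _) (eY _ _), P1]
    rfl
  · rw [fieldX_polyComp_pairing _ su]
    simp only [Pi.mul_apply, eX, mul_zero]
  · rw [fieldX_fieldY_diag _ h₁ h₂ su e0 (eX _ _), pairing_field2_field2]
    ring
  · rw [fieldX_fieldY_diag _ h₂ sw su e0 (eX _ _), pairing_field2_field2, P1]
    simp only [α, N, nV2]
    ring
  · rw [fieldX_fieldY_fieldY_diag _ h₁ h₂ su e0 (eX _ _) (eY _ _), P1]
    rfl
  · rw [fieldX_fieldX_polyComp_pairing _ h₁ h₂ su]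
    simp only [Pi.add_apply, Pi.mul_apply, eX, polyComp, e0, P1, eL]
    ring
  · rw [fieldX_fieldX_fieldY_diag _ h₁ h₂ h₁ h₂ su e0 (eX _ _) (eY _ _), P1, eT]
    rfl
  · rw [fieldX_fieldX_fieldY_diag _ h₁ h₂ h₂ sw su e0 (eX _ _) (eY _ _), P1, eS]
    rfl
  · rw [fieldX_fieldX_fieldY_fieldY_diag _ h₁ h₂ h₁ h₂ su e0 (eX _ _) (eY _ _), P1, P2, eL, eR, eN]
    simp only [α, β, N, R, normSqSecond]
    ring

lemma Dmat_eq {v₁ v₂ : ℝ → ℝ → ℝ} (h₁ : Smooth2 v₁) (h₂ : Smooth2 v₂) (l : ℕ) {θ φ : ℝ}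
    (hN : nV2 v₁ v₂ θ φ ≠ 0) :
    let α := ((l : ℝ) ^ 2 + l) / 2
    let β := ((l : ℝ) - 1) * l * (l + 1) * (l + 2) / 8
    let N := nV2 v₁ v₂ θ φ
    let S := perpSecond v₁ v₂ θ φ
    let T := tangSecond v₁ v₂ θ φ
    let R := normSqSecond v₁ v₂ θ φ
    Dmat v₁ v₂ l θ φ =
      !![α * (Real.sin φ ^ 2 * N), α * S;
         α * S, α * R + 3 * β * N ^ 2 - α ^ 2 * N ^ 2 - α * T ^ 2 * N⁻¹] := by
  intro α β N S T R
  have hA : Amat v₁ v₂ l θ φ = _ := Amat_eq h₁ h₂ l θ φ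
  have hinv : (!![1, 0; 0, α * N] : Matrix (Fin 2) (Fin 2) ℝ)⁻¹ =
      !![α * N * (α * N)⁻¹, 0; 0, (α * N)⁻¹] := by
    rw [Matrix.inv_def, Matrix.det_fin_two_of, Matrix.adjugate_fin_two_of]
    simp [mul_comm]
  have hα : α * α⁻¹ * α = α := mul_inv_mul_cancel α
  have hNN : N * N⁻¹ = 1 := mul_inv_cancel₀ hN
  simp only [Dmat, C11m, C12m, C21m, C22m, hA, Matrix.of_apply, Matrix.cons_val]
  rw [hinv, Matrix.mul_fin_two, Matrix.mul_fin_two]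
  ext i j
  fin_cases i <;> fin_cases j
  · simp [α, N]
  · simp [α, S]
  · simp [α, S]
  · have hM : N * α * ((N * α) * (N * α)⁻¹) = N * α := by
      rw [← mul_assoc]; exact mul_self_mul_inv _
    simp only [Fin.mk_one, Matrix.sub_apply, Matrix.of_apply, Matrix.cons_val, mul_inv]
    rw [mul_inv] at hM
    linear_combination (-(N * α)) * hM - T ^ 2 * N⁻¹ * hα

end ConditionalCovariance

/-- entries of the conditional covariance matrix `Δ_l(θ,φ)` at points where
`‖V‖ ≠ 0`: the `(1,1)` entry is `‖V^⊥‖²(l²+l)/2`, the off-diagonal entries are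
`ã₃₄(θ,φ)(l²+l)/2`, and the `(2,2)` entry is `‖V‖⁴(l⁴/8 + l³/4)` up to an error of size
`C_V (1 + ‖V‖⁻²) l²` with `C_V` depending only on `v₁, v₂` and their first derivatives. -/
theorem conditional_covariance_entries
    (v₁ v₂ : ℝ → ℝ → ℝ)
    (hv₁ : ContDiff ℝ (⊤ : ℕ∞) (Function.uncurry v₁)) (hv₂ : ContDiff ℝ (⊤ : ℕ∞) (Function.uncurry v₂))
    (hper₁ : ∀ θ φ : ℝ, v₁ (θ + 2 * π) φ = v₁ θ φ)
    (hper₂ : ∀ θ φ : ℝ, v₂ (θ + 2 * π) φ = v₂ θ φ) :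
    ∃ C : ℝ, ∀ (l : ℕ) (θ φ : ℝ), φ ∈ Set.Ioo 0 π → nV2 v₁ v₂ θ φ ≠ 0 →
      Dmat v₁ v₂ l θ φ 0 0 =
        (Real.sin φ) ^ 2 * nV2 v₁ v₂ θ φ * (((l : ℝ) ^ 2 + l) / 2) ∧
      Dmat v₁ v₂ l θ φ 0 1 =
        (v₂ θ φ * v₁ θ φ * deriv (fun t => v₁ t φ) θ * (Real.sin φ) ^ 2 +
          2 * (v₂ θ φ) ^ 2 * v₁ θ φ * Real.sin φ * Real.cos φ +
          (v₂ θ φ) ^ 2 * deriv (fun t => v₁ θ t) φ * (Real.sin φ) ^ 2 +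
          (v₁ θ φ) ^ 3 * Real.cos φ * (Real.sin φ) ^ 3 -
          (v₁ θ φ) ^ 2 * deriv (fun t => v₂ t φ) θ * (Real.sin φ) ^ 2 -
          v₁ θ φ * v₂ θ φ * deriv (fun t => v₂ θ t) φ * (Real.sin φ) ^ 2) *
          (((l : ℝ) ^ 2 + l) / 2) ∧
      Dmat v₁ v₂ l θ φ 1 0 = Dmat v₁ v₂ l θ φ 0 1 ∧
      |Dmat v₁ v₂ l θ φ 1 1 -
          (nV2 v₁ v₂ θ φ) ^ 2 * ((l : ℝ) ^ 4 / 8 + (l : ℝ) ^ 3 / 4)| ≤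
        C * (1 + (nV2 v₁ v₂ θ φ)⁻¹) * (l : ℝ) ^ 2 := by
  have su := smooth2_sphereEmb
  have sV := Smooth2.field2 hv₁ hv₂ su
  have sVV := Smooth2.field2 hv₁ hv₂ sV
  have pV := PeriodicFst.field2 hper₁ hper₂ periodicFst_sphereEmb
  have pVV := PeriodicFst.field2 hper₁ hper₂ pV
  obtain ⟨M₁, hM₁⟩ := exists_bound_pairing_diag su sVV periodicFst_sphereEmb pVV
  obtain ⟨M₂, hM₂⟩ := exists_bound_pairing_diag sV sVV pV pVV
  obtain ⟨M₃, hM₃⟩ := exists_bound_pairing_diag sVV sVV pVV pVV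
  refine ⟨2 * M₁ ^ 2 + M₂ ^ 2 + |M₃|, fun l θ φ hφ hN => ?_⟩
  rw [Dmat_eq hv₁ hv₂ l hN]
  refine ⟨?_, ?_, rfl, ?_⟩
  · simp only [Matrix.of_apply, Matrix.cons_val]
    ring
  · simp only [Matrix.of_apply, Matrix.cons_val, perpSecond]
    rw [pairing_field2_field2_field2 hv₁ hv₂]
    ring
  · simp only [Matrix.of_apply, Matrix.cons_val]
    have bN := hM₁ θ φ hφ
    rw [pairing_sphereEmb_field2_field2 hv₁ hv₂, abs_neg] at bN
    have bT : |tangSecond v₁ v₂ θ φ| ≤ M₂ := hM₂ θ φ hφ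
    have bR : |normSqSecond v₁ v₂ θ φ| ≤ |M₃| := (hM₃ θ φ hφ).trans (le_abs_self _)
    have hpos : 0 < (nV2 v₁ v₂ θ φ)⁻¹ := by
      refine inv_pos.mpr (lt_of_le_of_ne ?_ hN.symm)
      unfold nV2
      positivity
    have hl : (l : ℝ) ≤ (l : ℝ) ^ 2 := by exact_mod_cast Nat.le_self_pow two_ne_zero l
    have hl0 : (0 : ℝ) ≤ l := Nat.cast_nonneg l
    generalize nV2 v₁ v₂ θ φ = N at *
    generalize tangSecond v₁ v₂ θ φ = T at *
    generalize normSqSecond v₁ v₂ θ φ = R at *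
    generalize (l : ℝ) = x at *
    have hN2 : N ^ 2 ≤ M₁ ^ 2 := sq_le_sq' (abs_le.mp bN).1 (abs_le.mp bN).2
    have hT2 : T ^ 2 ≤ M₂ ^ 2 := sq_le_sq' (abs_le.mp bT).1 (abs_le.mp bT).2
    have hα0 : 0 ≤ (x ^ 2 + x) / 2 := by positivity
    have hα : (x ^ 2 + x) / 2 ≤ x ^ 2 := by linarith
    have k₁ : |(x ^ 2 + x) / 2 * R| ≤ x ^ 2 * |M₃| := by
      rw [abs_mul, abs_of_nonneg hα0]
      gcongr
    have k₂ : (x ^ 2 + x) / 2 * T ^ 2 * N⁻¹ ≤ x ^ 2 * M₂ ^ 2 * N⁻¹ := by gcongr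
    have k₃ : N ^ 2 * (5 / 8 * x ^ 2 + 3 / 4 * x) ≤ M₁ ^ 2 * (2 * x ^ 2) := by
      gcongr
      linarith
    have k₄ : 0 ≤ (x ^ 2 + x) / 2 * T ^ 2 * N⁻¹ := by positivity
    have k₅ : 0 ≤ N ^ 2 * (5 / 8 * x ^ 2 + 3 / 4 * x) := by positivity
    have k₆ : 0 ≤ x ^ 2 * (2 * M₁ ^ 2 + |M₃|) * N⁻¹ := by positivity
    have k₇ : 0 ≤ x ^ 2 * M₂ ^ 2 := by positivity
    have k₈ := abs_le.mp k₁
    rw [abs_le]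
    constructor <;> linarith
end
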